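/- (Semigroup / Chapman–Kolmogorov property.) For all real α, θ > 0 and ℓ ≥ 0, all integers k, N ≥ 0, all real times t < s < T and all x, y ∈ ℝ, one has ∫_ℝ (𝒞_θ^k Γ̄^{α,θ,ℓ}(s−t,·))(x−ξ) · (𝒞_θ^N Γ̄^{α,θ,ℓ}(T−s,·))(ξ−y) dξ = (𝒞_θ^{k+N} Γ̄^{α,θ,ℓ}(T−t,·))(x−y). -/

import Mathlib

open Real MeasureTheory

/-- Gaussian density component `Γ_n^{α,θ,ℓ}(t,x)`. -/
noncomputable def Gn (α θ l : ℝ) (n : ℕ) (t x : ℝ) : ℝ :=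
  (Real.sqrt (2 * Real.pi * (α * t + (n : ℝ) * θ)))⁻¹ *
    Real.exp (-(x - (α / 2 + l * (Real.exp (θ / 2) - 1)) * t) ^ 2 / (2 * (α * t + (n : ℝ) * θ)))

/-- Compound-Poisson jump-diffusion density `Γ^{α,θ,ℓ}(t,x)`. -/
noncomputable def G (α θ l : ℝ) (t x : ℝ) : ℝ :=
  Real.exp (-(l * t)) * ∑' n : ℕ, (l * t) ^ n / (Nat.factorial n : ℝ) * Gn α θ l n t x

/-- Centered Gaussian density component `Γ̄_n^{α,θ}(t,x)`. -/
noncomputable def GBn (α θ : ℝ) (n : ℕ) (t x : ℝ) : ℝ :=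
  (Real.sqrt (2 * Real.pi * (α * t + (n : ℝ) * θ)))⁻¹ *
    Real.exp (-x ^ 2 / (2 * (α * t + (n : ℝ) * θ)))

/-- Centered jump-diffusion density `Γ̄^{α,θ,ℓ}(t,x)`. -/
noncomputable def GB (α θ l : ℝ) (t x : ℝ) : ℝ :=
  Real.exp (-(l * t)) * ∑' n : ℕ, (l * t) ^ n / (Nat.factorial n : ℝ) * GBn α θ n t x

/-- Gaussian convolution operator `𝒞_θ`. -/
noncomputable def conv (θ : ℝ) (f : ℝ → ℝ) (x : ℝ) : ℝ :=
  ∫ z : ℝ, f (x + z) * ((Real.sqrt (2 * Real.pi * θ))⁻¹ * Real.exp (-z ^ 2 / (2 * θ)))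

/-- Centered Gaussian density with variance `v`. -/
noncomputable def gaussDensity (v x : ℝ) : ℝ :=
  (√(2 * π * v))⁻¹ * rexp (-x ^ 2 / (2 * v))

lemma gaussDensity_nonneg (v x : ℝ) : 0 ≤ gaussDensity v x := by
  unfold gaussDensity; positivity

lemma gaussDensity_le {δ v : ℝ} (hδ : 0 < δ) (h : δ ≤ v) (x : ℝ) :
    gaussDensity v x ≤ (√(2 * π * δ))⁻¹ := by
  have hv : 0 < v := hδ.trans_le h
  have h1 : (√(2 * π * v))⁻¹ ≤ (√(2 * π * δ))⁻¹ := by gcongr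
  have h2 : rexp (-x ^ 2 / (2 * v)) ≤ 1 := by
    rw [Real.exp_le_one_iff, neg_div]
    exact neg_nonpos.2 (by positivity)
  calc gaussDensity v x ≤ (√(2 * π * δ))⁻¹ * 1 := by unfold gaussDensity; gcongr
    _ = _ := mul_one _

lemma gaussDensity_mul {u v : ℝ} (hu : 0 < u) (hv : 0 < v) (x y ξ : ℝ) :
    gaussDensity u (x - ξ) * gaussDensity v (ξ - y) =
      (√(2 * π * u))⁻¹ * (√(2 * π * v))⁻¹ * rexp (-(x - y) ^ 2 / (2 * (u + v))) *
        rexp (-((u + v) / (2 * u * v)) * (ξ - (v * x + u * y) / (u + v)) ^ 2) := by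
  unfold gaussDensity
  rw [mul_mul_mul_comm, ← Real.exp_add, mul_assoc _ (rexp _), ← Real.exp_add]
  congr 2
  field_simp
  ring

lemma integrable_gaussDensity_mul {u v : ℝ} (hu : 0 < u) (hv : 0 < v) (x y : ℝ) :
    Integrable fun ξ ↦ gaussDensity u (x - ξ) * gaussDensity v (ξ - y) := by
  simp_rw [gaussDensity_mul hu hv]
  exact ((integrable_exp_neg_mul_sq (by positivity)).comp_sub_right _).const_mul _

lemma integral_gaussDensity_mul {u v : ℝ} (hu : 0 < u) (hv : 0 < v) (x y : ℝ) :
    ∫ ξ, gaussDensity u (x - ξ) * gaussDensity v (ξ - y) = gaussDensity (u + v) (x - y) := by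
  simp_rw [gaussDensity_mul hu hv]
  rw [integral_const_mul,
    integral_sub_right_eq_self (fun ξ ↦ rexp (-((u + v) / (2 * u * v)) * ξ ^ 2)),
    integral_gaussian, mul_right_comm]
  unfold gaussDensity
  congr 1
  rw [← Real.sqrt_inv, ← Real.sqrt_inv, ← Real.sqrt_inv, ← Real.sqrt_mul (by positivity),
    ← Real.sqrt_mul (by positivity)]
  congr 1
  field_simp

/-- Mixture of centered Gaussian densities with weights `a` and variances `u`. -/
noncomputable def gaussMix {ι : Type*} (a u : ι → ℝ) (x : ℝ) : ℝ :=
  ∑' i, a i * gaussDensity (u i) x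

lemma summable_mul_gaussDensity {ι : Type*} {a u : ι → ℝ} {δ : ℝ} (ha : Summable fun i ↦ ‖a i‖)
    (hδ : 0 < δ) (hu : ∀ i, δ ≤ u i) (x : ℝ) :
    Summable fun i ↦ ‖a i * gaussDensity (u i) x‖ := by
  refine (ha.mul_right (√(2 * π * δ))⁻¹).of_nonneg_of_le (fun _ ↦ norm_nonneg _) fun i ↦ ?_
  rw [norm_mul, Real.norm_of_nonneg (gaussDensity_nonneg _ _)]
  gcongr
  exact gaussDensity_le hδ (hu i) x

lemma integral_gaussMix_mul {ι κ : Type*} [Countable ι] [Countable κ] {a u : ι → ℝ}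
    {b v : κ → ℝ} {δ ε : ℝ} (ha : Summable fun i ↦ ‖a i‖) (hb : Summable fun j ↦ ‖b j‖)
    (hδ : 0 < δ) (hε : 0 < ε) (hu : ∀ i, δ ≤ u i) (hv : ∀ j, ε ≤ v j) (x y : ℝ) :
    ∫ ξ, gaussMix a u (x - ξ) * gaussMix b v (ξ - y) =
      gaussMix (fun p : ι × κ ↦ a p.1 * b p.2) (fun p ↦ u p.1 + v p.2) (x - y) := by
  have hu' i : 0 < u i := hδ.trans_le (hu i)
  have hv' j : 0 < v j := hε.trans_le (hv j)
  have hab : Summable fun p : ι × κ ↦ ‖a p.1 * b p.2‖ := by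
    simpa using ha.mul_norm hb
  let F (p : ι × κ) (ξ : ℝ) : ℝ :=
    a p.1 * b p.2 * (gaussDensity (u p.1) (x - ξ) * gaussDensity (v p.2) (ξ - y))
  have hF p : Integrable (F p) :=
    (integrable_gaussDensity_mul (hu' p.1) (hv' p.2) x y).const_mul _
  have hnorm p : ∫ ξ, ‖F p ξ‖ = ‖a p.1 * b p.2 * gaussDensity (u p.1 + v p.2) (x - y)‖ := by
    rw [norm_mul, Real.norm_of_nonneg (gaussDensity_nonneg _ _),
      ← integral_gaussDensity_mul (hu' p.1) (hv' p.2), ← integral_const_mul]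
    congr with ξ
    rw [norm_mul, Real.norm_of_nonneg (mul_nonneg (gaussDensity_nonneg _ _)
      (gaussDensity_nonneg _ _))]
  have hsum : Summable fun p ↦ ∫ ξ, ‖F p ξ‖ := by
    simp_rw [hnorm]
    exact summable_mul_gaussDensity hab (add_pos hδ hε)
      (fun p : ι × κ ↦ add_le_add (hu p.1) (hv p.2)) _
  have key := integral_tsum_of_summable_integral_norm hF hsum
  have hprod ξ : gaussMix a u (x - ξ) * gaussMix b v (ξ - y) = ∑' p, F p ξ := by
    unfold gaussMix
    rw [tsum_mul_tsum_of_summable_norm (summable_mul_gaussDensity ha hδ hu _)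
      (summable_mul_gaussDensity hb hε hv _)]
    exact tsum_congr fun p ↦ mul_mul_mul_comm _ _ _ _
  simp_rw [hprod]
  rw [← key]
  refine tsum_congr fun p ↦ ?_
  rw [integral_const_mul, integral_gaussDensity_mul (hu' p.1) (hv' p.2)]

lemma conv_gaussMix {ι : Type*} [Countable ι] {a u : ι → ℝ} {δ θ : ℝ}
    (ha : Summable fun i ↦ ‖a i‖) (hδ : 0 < δ) (hθ : 0 < θ) (hu : ∀ i, δ ≤ u i) :
    conv θ (gaussMix a u) = gaussMix a (fun i ↦ u i + θ) := by
  ext x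
  have h := integral_gaussMix_mul (κ := Unit) (b := fun _ ↦ 1) (v := fun _ ↦ θ) ha
    Summable.of_finite hδ hθ hu (fun _ ↦ le_rfl) x 0
  have h1 : gaussMix (fun p : ι × Unit ↦ a p.1 * 1) (fun p ↦ u p.1 + θ) (x - 0) =
      gaussMix a (fun i ↦ u i + θ) x := by
    rw [sub_zero]
    unfold gaussMix
    rw [← (Equiv.prodUnique ι Unit).tsum_eq]
    simp [Equiv.prodUnique]
  rw [← h1, ← h, ← integral_neg_eq_self]
  simp [conv, gaussMix, gaussDensity]

lemma conv_iterate_gaussMix {ι : Type*} [Countable ι] {a u : ι → ℝ} {δ θ : ℝ}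
    (ha : Summable fun i ↦ ‖a i‖) (hδ : 0 < δ) (hθ : 0 < θ) (hu : ∀ i, δ ≤ u i) (k : ℕ) :
    (conv θ)^[k] (gaussMix a u) = gaussMix a (fun i ↦ u i + k * θ) := by
  induction k with
  | zero => simp
  | succ k ih =>
    rw [Function.iterate_succ_apply', ih, conv_gaussMix ha hδ hθ fun i ↦
      (hu i).trans (le_add_of_nonneg_right (by positivity))]
    congr with i
    push_cast
    ring

lemma summable_norm_poisson (r : ℝ) :
    Summable fun n : ℕ ↦ ‖rexp (-r) * (r ^ n / (n.factorial : ℝ))‖ :=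
  ((Real.summable_pow_div_factorial r).mul_left _).norm

lemma GB_eq_gaussMix (α θ l t : ℝ) :
    GB α θ l t = gaussMix (fun n : ℕ ↦ rexp (-(l * t)) * ((l * t) ^ n / (n.factorial : ℝ)))
      (fun n ↦ α * t + n * θ) := by
  ext x
  simp only [GB, gaussMix, mul_assoc, tsum_mul_left]
  rfl

lemma conv_iterate_GB {α θ t : ℝ} (l : ℝ) (hα : 0 < α) (hθ : 0 < θ) (ht : 0 < t) (k : ℕ) :
    (conv θ)^[k] (GB α θ l t) =
      gaussMix (fun n : ℕ ↦ rexp (-(l * t)) * ((l * t) ^ n / (n.factorial : ℝ)))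
        (fun n ↦ α * t + n * θ + k * θ) := by
  rw [GB_eq_gaussMix]
  exact conv_iterate_gaussMix (summable_norm_poisson _) (mul_pos hα ht) hθ
    (fun n ↦ le_add_of_nonneg_right (by positivity)) k

lemma sum_antidiagonal_pow_div_factorial (a b : ℝ) (n : ℕ) :
    ∑ p ∈ Finset.HasAntidiagonal.antidiagonal n,
      a ^ p.1 / (p.1.factorial : ℝ) * (b ^ p.2 / (p.2.factorial : ℝ)) =
        (a + b) ^ n / (n.factorial : ℝ) := by
  rw [(Commute.all a b).add_pow', Finset.sum_div]
  refine Finset.sum_congr rfl fun p hp ↦ ?_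
  obtain rfl := Finset.HasAntidiagonal.mem_antidiagonal.1 hp
  have h := Nat.add_choose_mul_factorial_mul_factorial p.1 p.2
  rw [← h, nsmul_eq_mul, Nat.choose_symm_add]
  have h0 : ((p.1 + p.2).choose p.2 : ℝ) ≠ 0 := by
    exact_mod_cast (Nat.choose_pos (Nat.le_add_left _ _)).ne'
  push_cast
  field_simp

lemma tsum_prod_poisson {f : ℕ → ℝ} (r r' : ℝ)
    (hf : Summable fun p : ℕ × ℕ ↦ rexp (-r) * (r ^ p.1 / (p.1.factorial : ℝ)) *
      (rexp (-r') * (r' ^ p.2 / (p.2.factorial : ℝ))) * f (p.1 + p.2)) :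
    ∑' p : ℕ × ℕ, rexp (-r) * (r ^ p.1 / (p.1.factorial : ℝ)) *
      (rexp (-r') * (r' ^ p.2 / (p.2.factorial : ℝ))) * f (p.1 + p.2) =
        ∑' n : ℕ, rexp (-(r + r')) * ((r + r') ^ n / (n.factorial : ℝ)) * f n := by
  rw [← Finset.HasAntidiagonal.sigmaAntidiagonalEquivProd.tsum_eq]
  rw [← Finset.HasAntidiagonal.sigmaAntidiagonalEquivProd.summable_iff] at hf
  refine (Summable.tsum_sigma' (fun n ↦ (hasSum_fintype _).summable) hf).trans
    (tsum_congr fun n ↦ ?_)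
  simp only [Function.comp_apply]
  rw [← sum_antidiagonal_pow_div_factorial, Finset.mul_sum, Finset.sum_mul, tsum_fintype,
    ← Finset.sum_coe_sort (Finset.HasAntidiagonal.antidiagonal n)]
  refine Finset.sum_congr rfl fun p _ ↦ ?_
  simp only [Finset.HasAntidiagonal.sigmaAntidiagonalEquivProd_apply]
  rw [Finset.HasAntidiagonal.mem_antidiagonal.1 p.2, neg_add, Real.exp_add]
  ring

/-- Semigroup (Chapman–Kolmogorov) property of the convolved centered densities. -/
theorem stmt7 (α θ l : ℝ) (hα : 0 < α) (hθ : 0 < θ) (hl : 0 ≤ l)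
    (k N : ℕ) (t s T : ℝ) (hts : t < s) (hsT : s < T) (x y : ℝ) :
    (∫ ξ : ℝ, (conv θ)^[k] (GB α θ l (s - t)) (x - ξ) *
        (conv θ)^[N] (GB α θ l (T - s)) (ξ - y)) =
      (conv θ)^[k + N] (GB α θ l (T - t)) (x - y) := by
  have hs : 0 < s - t := sub_pos.2 hts
  have hT : 0 < T - s := sub_pos.2 hsT
  have hu (τ : ℝ) (j n : ℕ) : α * τ ≤ α * τ + n * θ + j * θ := by
    rw [add_assoc]; exact le_add_of_nonneg_right (by positivity)
  rw [conv_iterate_GB l hα hθ hs, conv_iterate_GB l hα hθ hT,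
    conv_iterate_GB l hα hθ (sub_pos.2 (hts.trans hsT)),
    integral_gaussMix_mul (summable_norm_poisson _) (summable_norm_poisson _) (mul_pos hα hs)
      (mul_pos hα hT) (hu _ k) (hu _ N)]
  have hvar (p : ℕ × ℕ) : α * (s - t) + p.1 * θ + k * θ + (α * (T - s) + p.2 * θ + N * θ) =
      α * (T - t) + ((p.1 + p.2 : ℕ) : ℝ) * θ + ((k + N : ℕ) : ℝ) * θ := by
    push_cast; ring
  have hl' : l * (T - t) = l * (s - t) + l * (T - s) := by ring
  have hab : Summable fun p : ℕ × ℕ ↦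
      ‖rexp (-(l * (s - t))) * ((l * (s - t)) ^ p.1 / (p.1.factorial : ℝ)) *
        (rexp (-(l * (T - s))) * ((l * (T - s)) ^ p.2 / (p.2.factorial : ℝ)))‖ := by
    simpa using (summable_norm_poisson (l * (s - t))).mul_norm
      (summable_norm_poisson (l * (T - s)))
  simp only [gaussMix, hvar]
  rw [hl']
  exact tsum_prod_poisson
    (f := fun n ↦ gaussDensity (α * (T - t) + n * θ + ((k + N : ℕ) : ℝ) * θ) (x - y)) _ _
    (summable_mul_gaussDensity hab (mul_pos hα (sub_pos.2 (hts.trans hsT)))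
      (fun p ↦ hu _ (k + N) (p.1 + p.2)) _).of_norm
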